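/- arXiv:1901.07502 — 10 statements merged into one kernel-verified Lean document; each statement's English description precedes it below -/
import Mathlib

section
/- Let w1 and w2 be binary words of equal length, and suppose the concatenation w1·w2 has length n and contains equally many zeros and ones. Then there exists k with 4k ≥ n such that either 0^k is a subsequence of w1 and 1^k is a subsequence of w2, or 1^k is a subsequence of w1 and 0^k is a subsequence of w2. In particular, taking s1, s2 to be these constant words, s1 is a subsequence of w1, s2 is a subsequence of w2, |s1| = |s2| = k ≥ n/4, and s1·s2 is an antipalindrome. -/
/-- The length of a binary word is the number of its zeros plus the number of its ones. -/
theorem length_eq_count_zero_add_count_one (w : List (Fin 2)) :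
    w.length = w.count 0 + w.count 1 := by
  induction w with
  | nil => rfl
  | cons a w ih =>
    fin_cases a <;> simp [ih] <;> lia

/-- If `w1` and `w2` are binary words of equal length whose concatenation
has length `n` and equally many zeros and ones, then there is `k` with `4 * k ≥ n` such that
either `0^k` is a subsequence of `w1` and `1^k` of `w2`, or `1^k` is a subsequence of `w1`
and `0^k` of `w2`.  (The constant words `s1 = a^k`, `s2 = b^k` then satisfy
`s1 <+ w1`, `s2 <+ w2`, `|s1| = |s2| = k ≥ n / 4`, and `s1 ++ s2` is an antipalindrome.) -/
theorem antipalindromic_quarter_bound (w1 w2 : List (Fin 2)) (n : ℕ)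
    (hlen : w1.length = w2.length) (hn : (w1 ++ w2).length = n)
    (hbal : (w1 ++ w2).count 0 = (w1 ++ w2).count 1) :
    ∃ k : ℕ, 4 * k ≥ n ∧
      ((List.replicate k (0 : Fin 2)).Sublist w1 ∧ (List.replicate k (1 : Fin 2)).Sublist w2 ∨
       (List.replicate k (1 : Fin 2)).Sublist w1 ∧ (List.replicate k (0 : Fin 2)).Sublist w2) := by
  have h1 := length_eq_count_zero_add_count_one w1
  have h2 := length_eq_count_zero_add_count_one w2
  rw [List.count_append, List.count_append] at hbal
  rw [List.length_append] at hn
  simp only [List.replicate_sublist_iff]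
  rcases le_total (w1.count 0) (w1.count 1) with h | h
  · exact ⟨w1.count 1, by lia, Or.inr ⟨le_rfl, by lia⟩⟩
  · exact ⟨w1.count 0, by lia, Or.inl ⟨le_rfl, by lia⟩⟩
end

section
/- For every binary word w of length n divisible by 4, there exist an index i, a letter b ∈ {0,1}, and an integer k with 4k ≥ n such that, writing the rotation w.rotate i as u1 ++ u2 with |u1| = |u2| = n/2, the constant word b^k is a subsequence of u1 and also a subsequence of u2. In particular the circular word represented by w can be cut into two equal halves carrying subsequences s1 = b^k and s2 = b^k with s1 = s2 reversed and |s1·s2| ≥ n/2. -/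
/-- Rotating by one letter raises the number of occurrences in a prefix window by at most one. -/
theorem List.count_take_rotate_one_le {α : Type*} [DecidableEq α] (b : α) (l : List α) (h : ℕ)
    (hl : h ≤ l.length) :
    ((l.rotate 1).take h).count b ≤ (l.take h).count b + 1 := by
  cases l with
  | nil => simp
  | cons a t =>
    cases h with
    | zero => simp
    | succ h =>
      have hht : h ≤ t.length := by simpa using hl
      rw [List.rotate_cons_succ, List.rotate_zero, List.take_add_one,
        List.take_append_of_le_length hht, List.count_append, List.take_succ_cons]
      have hlast : ((t ++ [a])[h]?.toList).count b ≤ 1 :=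
        List.count_le_length.trans (by cases (t ++ [a])[h]? <;> simp)
      have hmono : (t.take h).count b ≤ (a :: t.take h).count b := List.count_le_count_cons
      omega

/-- Discrete intermediate value property of the prefix-window counts along rotations. -/
theorem List.exists_count_take_rotate_eq {α : Type*} [DecidableEq α] (b : α) (l : List α)
    {h m j : ℕ} (hl : h ≤ l.length) (h0 : (l.take h).count b < m)
    (hj : m ≤ ((l.rotate j).take h).count b) :
    ∃ i, ((l.rotate i).take h).count b = m := by
  have hex : ∃ i, m ≤ ((l.rotate i).take h).count b := ⟨j, hj⟩
  classical
  refine ⟨Nat.find hex, le_antisymm ?_ (Nat.find_spec hex)⟩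
  rcases hi : Nat.find hex with _ | i
  · simpa using h0.le
  · have hlt : ¬ m ≤ ((l.rotate i).take h).count b := Nat.find_min hex (by omega)
    have hstep := List.count_take_rotate_one_le b (l.rotate i) h (by simpa using hl)
    rw [List.rotate_rotate] at hstep
    omega

/-- If `b` occurs at least `2 * m` times in a word of length `2 * h`, some rotation has at least
`m` occurrences of `b` in each of its two halves. -/
theorem List.exists_rotate_le_count_halves {α : Type*} [DecidableEq α] (b : α) (l : List α)
    {h m : ℕ} (hl : l.length = 2 * h) (hb : 2 * m ≤ l.count b) :
    ∃ i, m ≤ ((l.rotate i).take h).count b ∧ m ≤ ((l.rotate i).drop h).count b := by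
  have hsum (i : ℕ) : ((l.rotate i).take h).count b + ((l.rotate i).drop h).count b
      = l.count b := by
    rw [← List.count_append, List.take_append_drop]
    exact (List.rotate_perm l i).count_eq b
  have hrot : l.rotate h = l.drop h ++ l.take h :=
    List.rotate_eq_drop_append_take (by omega)
  have htake : (l.rotate h).take h = l.drop h := by
    rw [hrot, List.take_left' (by rw [List.length_drop]; omega)]
  have hsum0 := hsum 0
  rw [List.rotate_zero] at hsum0
  by_cases h1 : (l.take h).count b < m
  · obtain ⟨i, hi⟩ := List.exists_count_take_rotate_eq b l (j := h) (by omega) h1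
      (by rw [htake]; omega)
    have := hsum i
    exact ⟨i, by omega, by omega⟩
  by_cases h2 : (l.drop h).count b < m
  · obtain ⟨i, hi⟩ := List.exists_count_take_rotate_eq b (l.rotate h) (h := h) (j := h)
      (by rw [List.length_rotate]; omega) (by rwa [htake])
      (by rw [List.rotate_rotate, ← two_mul, ← hl, List.rotate_length]; omega)
    rw [List.rotate_rotate] at hi
    have := hsum (h + i)
    exact ⟨h + i, by omega, by omega⟩
  exact ⟨0, by rw [List.rotate_zero]; omega, by rw [List.rotate_zero]; omega⟩


/-- Every binary circular word of length `n` divisible by `4` can be cut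
(after some rotation) into two halves `u1, u2` of length `n / 2` that share a common constant
subsequence `b^k` with `4 * k ≥ n`; thus `s1 = b^k` and `s2 = b^k` satisfy `s1 = s2.reverse`
and `|s1 ++ s2| ≥ n / 2`. -/
theorem palindromic_half_bound_circular (w : List (Fin 2)) (n : ℕ)
    (hn : w.length = n) (hdvd : 4 ∣ n) :
    ∃ (i : ℕ) (b : Fin 2) (k : ℕ), 4 * k ≥ n ∧
      ∃ u1 u2 : List (Fin 2), w.rotate i = u1 ++ u2 ∧
        u1.length = n / 2 ∧ u2.length = n / 2 ∧
        (List.replicate k b).Sublist u1 ∧ (List.replicate k b).Sublist u2 := by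
  obtain ⟨m, rfl⟩ := hdvd
  have hmajority : ∃ b : Fin 2, 2 * m ≤ w.count b := by
    have htotal : w.count 0 + w.count 1 = w.length := by
      have := Multiset.sum_count_eq_card (s := Finset.univ) (m := (w : Multiset (Fin 2)))
        (fun a _ => Finset.mem_univ a)
      simpa [Fin.sum_univ_two] using this
    by_cases h0 : 2 * m ≤ w.count 0
    · exact ⟨0, h0⟩
    · exact ⟨1, by omega⟩
  obtain ⟨b, hb⟩ := hmajority
  have hhalf : 4 * m / 2 = 2 * m := by omega
  obtain ⟨i, htake, hdrop⟩ :=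
    List.exists_rotate_le_count_halves b w (h := 2 * m) (by omega) hb
  refine ⟨i, b, m, le_rfl, (w.rotate i).take (2 * m), (w.rotate i).drop (2 * m),
    (List.take_append_drop _ _).symm, ?_, ?_, ?_, ?_⟩
  · rw [List.length_take, List.length_rotate]; omega
  · rw [List.length_drop, List.length_rotate]; omega
  · exact List.replicate_sublist_iff.mpr htake
  · exact List.replicate_sublist_iff.mpr hdrop
end

section
/- Let w1, w2, w3, w4 be binary words of equal length ℓ (so the circular word w = w1w2w3w4 has length n = 4ℓ). Then there exists a word p with 3·|p| ≥ 2ℓ (equivalently 6|p| ≥ n, so the palindrome p·p^R has length at least n/3) such that either p is a subsequence of w1·w2 and the reversal of p is a subsequence of w3·w4, or p is a subsequence of w2·w3 and the reversal of p is a subsequence of w4·w1. -/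
open List

/-- The constant word `c ^ k`, with `k` the smaller number of occurrences of `c` in `u` and in `v`,
is a subsequence of `u` whose reversal is a subsequence of `v`. -/
theorem exists_sublist_reverse_sublist_of_count {α : Type*} [DecidableEq α] (c : α)
    (u v : List α) :
    ∃ p : List α, p.length = min (u.count c) (v.count c) ∧ p <+ u ∧ p.reverse <+ v := by
  refine ⟨replicate (min (u.count c) (v.count c)) c, length_replicate, ?_, ?_⟩
  · exact replicate_sublist_iff.2 (min_le_left _ _)
  · rw [reverse_replicate]
    exact replicate_sublist_iff.2 (min_le_right _ _)

/-- Nested matchings concatenate: match `u₁` with `u₄` by the letter `c` and `u₂` with `u₃` by the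
letter `d`. -/
theorem exists_sublist_append_reverse_sublist_append {α : Type*} [DecidableEq α] (c d : α)
    (u₁ u₂ u₃ u₄ : List α) :
    ∃ p : List α,
      p.length = min (u₁.count c) (u₄.count c) + min (u₂.count d) (u₃.count d) ∧
      p <+ u₁ ++ u₂ ∧ p.reverse <+ u₃ ++ u₄ := by
  obtain ⟨p, hp, hp₁, hp₄⟩ := exists_sublist_reverse_sublist_of_count c u₁ u₄
  obtain ⟨q, hq, hq₂, hq₃⟩ := exists_sublist_reverse_sublist_of_count d u₂ u₃
  refine ⟨p ++ q, by rw [length_append, hp, hq], hp₁.append hq₂, ?_⟩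
  rw [reverse_append]
  exact hq₃.append hp₄

/-- In a binary word the numbers of zeros and ones add up to the length. -/
theorem count_zero_add_count_one (w : List (Fin 2)) : w.count 0 + w.count 1 = w.length := by
  induction w with
  | nil => rfl
  | cons a w ih => fin_cases a <;> simp <;> omega

/-- For binary words `w1, w2, w3, w4` of equal length `ℓ` (representing a
circular word of length `n = 4ℓ`), there is a word `p` with `3 * |p| ≥ 2 * ℓ` (so the
palindrome `p ++ p.reverse` has length at least `n / 3`) such that either `p` is a subsequence
of `w1 ++ w2` and `p.reverse` of `w3 ++ w4`, or `p` is a subsequence of `w2 ++ w3` and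
`p.reverse` of `w4 ++ w1`. -/
theorem two_cuts_palindrome_third_bound (ℓ : ℕ) (w1 w2 w3 w4 : List (Fin 2))
    (h1 : w1.length = ℓ) (h2 : w2.length = ℓ) (h3 : w3.length = ℓ) (h4 : w4.length = ℓ) :
    ∃ p : List (Fin 2), 3 * p.length ≥ 2 * ℓ ∧
      (p.Sublist (w1 ++ w2) ∧ p.reverse.Sublist (w3 ++ w4) ∨
       p.Sublist (w2 ++ w3) ∧ p.reverse.Sublist (w4 ++ w1)) := by
  by_contra! hno
  have const_left (c : Fin 2) :
      3 * min (w1.count c + w2.count c) (w3.count c + w4.count c) < 2 * ℓ := by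
    obtain ⟨p, hp, hu, hv⟩ := exists_sublist_reverse_sublist_of_count c (w1 ++ w2) (w3 ++ w4)
    rw [count_append, count_append] at hp
    by_contra! hlen
    exact (hno p (by omega)).1 hu hv
  have const_right (c : Fin 2) :
      3 * min (w2.count c + w3.count c) (w4.count c + w1.count c) < 2 * ℓ := by
    obtain ⟨p, hp, hu, hv⟩ := exists_sublist_reverse_sublist_of_count c (w2 ++ w3) (w4 ++ w1)
    rw [count_append, count_append] at hp
    by_contra! hlen
    exact (hno p (by omega)).2 hu hv
  have nested_left (c d : Fin 2) :
      3 * (min (w1.count c) (w4.count c) + min (w2.count d) (w3.count d)) < 2 * ℓ := by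
    obtain ⟨p, hp, hu, hv⟩ := exists_sublist_append_reverse_sublist_append c d w1 w2 w3 w4
    by_contra! hlen
    exact (hno p (by omega)).1 hu hv
  have nested_right (c d : Fin 2) :
      3 * (min (w2.count c) (w1.count c) + min (w3.count d) (w4.count d)) < 2 * ℓ := by
    obtain ⟨p, hp, hu, hv⟩ := exists_sublist_append_reverse_sublist_append c d w2 w3 w4 w1
    by_contra! hlen
    exact (hno p (by omega)).2 hu hv
  have := count_zero_add_count_one w1
  have := count_zero_add_count_one w2
  have := count_zero_add_count_one w3
  have := count_zero_add_count_one w4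
  have left : (3 * (w1.count 1 + w2.count 1) < 2 * ℓ ∧ 3 * (w3.count 0 + w4.count 0) < 2 * ℓ) ∨
      (3 * (w1.count 0 + w2.count 0) < 2 * ℓ ∧ 3 * (w3.count 1 + w4.count 1) < 2 * ℓ) := by
    have := const_left 0
    have := const_left 1
    omega
  have right : (3 * (w2.count 1 + w3.count 1) < 2 * ℓ ∧ 3 * (w4.count 0 + w1.count 0) < 2 * ℓ) ∨
      (3 * (w2.count 0 + w3.count 0) < 2 * ℓ ∧ 3 * (w4.count 1 + w1.count 1) < 2 * ℓ) := by
    have := const_right 0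
    have := const_right 1
    omega
  rcases left with left | left <;> rcases right with right | right
  · have := nested_left 1 0
    have := nested_right 0 1
    omega
  · have := nested_left 0 1
    have := nested_right 0 1
    omega
  · have := nested_left 1 0
    have := nested_right 1 0
    omega
  · have := nested_left 0 1
    have := nested_right 1 0
    omega
end

section
/- Let k ≥ 2, let w1 ∈ S_{n1} be a word of type n1 and length ℓ1, and let w2 ∈ S_{n2} be a word of type n2 and length ℓ2, where n1 > n2 ≥ 1. Then every common subsequence v of w1 and w2 satisfies |v| ≤ (ℓ1 + ℓ2)/(k+1) + ℓ1·n2/n1 + 2·n2 (an inequality of rational numbers; equivalently, (k+1)·n1·|v| ≤ n1·(ℓ1 + ℓ2) + (k+1)·ℓ1·n2 + 2·(k+1)·n1·n2). -/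
/-- The block word `B(n) = 0^n 1^n ⋯ (k-1)^n` over the alphabet `{0, …, k-1}`. -/
def blockWord (k n : ℕ) : List ℕ := (List.range k).flatMap fun a => List.replicate n a

/-- A word `w` is of type `n` (written `w ∈ S_n`) if, for some `m`, it is an infix of
`B(n)^m` or of the reversal of `B(n)^m`. -/
def IsTypeWord (k n : ℕ) (w : List ℕ) : Prop :=
  ∃ m : ℕ, w <:+: (List.replicate m (blockWord k n)).flatten ∨
    w <:+: (List.replicate m (blockWord k n)).flatten.reverse

/-- The letter at position `i` of the periodic word `B(n) B(n) ⋯`. -/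
def blockLetter (k n i : ℕ) : ℕ := i / n % k

theorem blockWord_succ (k n : ℕ) :
    blockWord (k + 1) n = blockWord k n ++ List.replicate n k := by
  simp [blockWord, List.range_succ]

theorem count_blockWord (k n a : ℕ) :
    (blockWord k n).count a = if a < k then n else 0 := by
  induction k with
  | zero => simp [blockWord]
  | succ k ih =>
    rw [blockWord_succ, List.count_append, ih, List.count_replicate]
    grind

theorem blockWord_eq_map_div {n : ℕ} (k : ℕ) (hn : 0 < n) :
    blockWord k n = (List.range (k * n)).map (· / n) := by
  induction k with
  | zero => simp [blockWord]
  | succ k ih =>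
    rw [blockWord_succ, ih, Nat.succ_mul, List.range_add, List.map_append, List.map_map]
    congr 1
    symm
    rw [List.eq_replicate_iff]
    refine ⟨by simp, ?_⟩
    simp only [List.mem_map, List.mem_range, Function.comp]
    rintro _ ⟨i, hi, rfl⟩
    rw [mul_comm, Nat.mul_add_div hn, Nat.div_eq_of_lt hi, Nat.add_zero]

theorem blockWord_eq_map_blockLetter {n : ℕ} (k : ℕ) (hn : 0 < n) :
    blockWord k n = (List.range (k * n)).map (blockLetter k n) := by
  rw [blockWord_eq_map_div k hn]
  refine List.map_congr_left fun i hi => ?_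
  rw [List.mem_range] at hi
  exact (Nat.mod_eq_of_lt (Nat.div_lt_of_lt_mul (by rwa [mul_comm]))).symm

theorem blockLetter_add_period {n : ℕ} (k i : ℕ) (hn : 0 < n) :
    blockLetter k n (i + k * n) = blockLetter k n i := by
  simp [blockLetter, Nat.add_mul_div_right _ _ hn]

theorem flatten_replicate_blockWord {n : ℕ} (k m : ℕ) (hn : 0 < n) :
    (List.replicate m (blockWord k n)).flatten =
      (List.range (m * (k * n))).map (blockLetter k n) := by
  induction m with
  | zero => simp
  | succ m ih =>
    rw [List.replicate_succ, List.flatten_cons, ih, Nat.succ_mul, add_comm, List.range_add,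
      List.map_append, List.map_map, ← blockWord_eq_map_blockLetter k hn]
    congr 1
    refine List.map_congr_left fun i _ => ?_
    simp only [Function.comp, add_comm (k * n), blockLetter_add_period k i hn]

theorem exists_eq_map_range'_of_infix_map_range {α : Type*} {f : ℕ → α} {N : ℕ} {u : List α}
    (h : u <:+: (List.range N).map f) : ∃ s, u = (List.range' s u.length).map f := by
  obtain ⟨p, q, h⟩ := h
  refine ⟨p.length, List.ext_getElem (by simp) fun i hi _ => ?_⟩
  have hlen : (p ++ u ++ q).length = ((List.range N).map f).length := by rw [h]
  have hi' : p.length + i < (p ++ u ++ q).length := by simp; omega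
  have key : (p ++ u ++ q)[p.length + i] =
      ((List.range N).map f)[p.length + i]'(hlen ▸ hi') := by
    simp only [h]
  simpa [List.getElem_append, hi] using key

theorem IsTypeWord.reverse {k n : ℕ} {w : List ℕ} (h : IsTypeWord k n w) :
    IsTypeWord k n w.reverse := by
  obtain ⟨m, h | h⟩ := h
  · exact ⟨m, Or.inr (List.reverse_infix.mpr h)⟩
  · exact ⟨m, Or.inl (by simpa using List.reverse_infix.mpr h)⟩

theorem IsTypeWord.of_infix {k n : ℕ} {u w : List ℕ} (h : IsTypeWord k n w) (hu : u <:+: w) :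
    IsTypeWord k n u := by
  obtain ⟨m, h | h⟩ := h
  · exact ⟨m, Or.inl (hu.trans h)⟩
  · exact ⟨m, Or.inr (hu.trans h)⟩

/-- Up to reversal, a word of type `n` is a window of the periodic word `B(n) B(n) ⋯`. -/
theorem IsTypeWord.eq_window_or_reverse_eq_window {k n : ℕ} {w : List ℕ} (hn : 0 < n)
    (h : IsTypeWord k n w) :
    (∃ s, w = (List.range' s w.length).map (blockLetter k n)) ∨
      ∃ s, w.reverse = (List.range' s w.length).map (blockLetter k n) := by
  obtain ⟨m, h | h⟩ := h
  · rw [flatten_replicate_blockWord k m hn] at h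
    exact Or.inl (exists_eq_map_range'_of_infix_map_range h)
  · rw [← List.reverse_infix, List.reverse_reverse, flatten_replicate_blockWord k m hn] at h
    simpa using Or.inr (exists_eq_map_range'_of_infix_map_range h)

theorem count_period_window_le {k n : ℕ} (hk : 0 < k) (hn : 0 < n) (a s : ℕ) :
    ((List.range' s (k * n)).map (blockLetter k n)).count a ≤ n := by
  induction s with
  | zero =>
    rw [← List.range_eq_range', ← blockWord_eq_map_blockLetter k hn, count_blockWord]
    split <;> omega
  | succ s ih =>
    obtain ⟨d, hd⟩ := Nat.exists_eq_succ_of_ne_zero (Nat.mul_pos hk hn).ne'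
    have hper := blockLetter_add_period k s hn
    rw [hd] at ih hper ⊢
    rw [List.range'_succ] at ih
    rw [Nat.succ_eq_add_one, List.range'_concat]
    simp only [List.map_append, List.map_cons, List.map_nil, List.count_append, List.count_cons,
      List.count_nil] at ih ⊢
    rw [show s + 1 + 1 * d = s + d.succ by omega, hper]
    omega

theorem mul_count_window_le {k n : ℕ} (hk : 0 < k) (hn : 0 < n) (a s len : ℕ) :
    k * ((List.range' s len).map (blockLetter k n)).count a ≤ len + k * n := by
  induction len using Nat.strong_induction_on generalizing s with
  | _ len ih =>
    have hpos := Nat.mul_pos hk hn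
    rcases le_total (k * n) len with h | h
    · obtain ⟨d, rfl⟩ := Nat.exists_eq_add_of_le h
      rw [← List.range'_append_1, List.map_append, List.count_append, mul_add]
      have h1 := Nat.mul_le_mul_left k (count_period_window_le hk hn a s)
      have h2 := ih d (by omega) (s + k * n)
      omega
    · have hsub : (List.range' s len).Sublist (List.range' s (k * n)) :=
        List.range'_sublist_right.mpr h
      have h1 := ((hsub.map (blockLetter k n)).count_le a).trans (count_period_window_le hk hn a s)
      exact (Nat.mul_le_mul_left k h1).trans (Nat.le_add_left _ _)

theorem IsTypeWord.mul_count_le {k n : ℕ} {w : List ℕ} (hk : 0 < k) (hn : 0 < n)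
    (h : IsTypeWord k n w) (a : ℕ) : k * w.count a ≤ w.length + k * n := by
  obtain ⟨s, hs⟩ | ⟨s, hs⟩ := h.eq_window_or_reverse_eq_window hn
  · have := mul_count_window_le hk hn a s w.length
    rwa [← hs] at this
  · have := mul_count_window_le hk hn a s w.length
    rwa [← hs, List.count_reverse] at this

theorem blockLetter_eq_of_mem_range' {k n s len : ℕ} (h : s % n + len ≤ n) (i : ℕ)
    (hi : i ∈ List.range' s len) : blockLetter k n i = blockLetter k n s := by
  rw [List.mem_range'_1] at hi
  obtain ⟨j, rfl⟩ := Nat.exists_eq_add_of_le hi.1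
  have hn : 0 < n := by omega
  have hdiv : (s + j) / n = s / n := by
    conv_lhs => rw [← Nat.div_add_mod s n, add_assoc, Nat.mul_add_div hn,
      Nat.div_eq_of_lt (by omega : s % n + j < n), Nat.add_zero]
  rw [blockLetter, hdiv, blockLetter]

/-- A window of the periodic word splits into constant blocks, whose number is controlled by the
length of the window. -/
theorem exists_constant_blocks {n : ℕ} (k : ℕ) (hn : 0 < n) (s len : ℕ) :
    ∃ L : List (List ℕ), L.flatten = (List.range' s len).map (blockLetter k n) ∧
      (∀ b ∈ L, ∃ a, ∀ x ∈ b, x = a) ∧ n * L.length ≤ len + s % n + n := by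
  induction len using Nat.strong_induction_on generalizing s with
  | _ len ih =>
    have hmod := Nat.mod_lt s hn
    rcases le_total (s % n + len) n with h | h
    · refine ⟨[(List.range' s len).map (blockLetter k n)], by simp, ?_, by simp⟩
      simp only [List.mem_singleton, forall_eq, List.mem_map]
      refine ⟨blockLetter k n s, ?_⟩
      rintro _ ⟨i, hi, rfl⟩
      exact blockLetter_eq_of_mem_range' h i hi
    · obtain ⟨d, hd⟩ := Nat.exists_eq_add_of_le (show n - s % n ≤ len by omega)
      obtain ⟨L, hL, hconst, hlen⟩ := ih d (by omega) (s + (n - s % n))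
      have haligned : (s + (n - s % n)) % n = 0 := by
        have hsum : s + (n - s % n) = n * (s / n + 1) := by
          have := Nat.div_add_mod s n
          rw [mul_add]
          omega
        rw [hsum, Nat.mul_mod_right]
      refine ⟨(List.range' s (n - s % n)).map (blockLetter k n) :: L, ?_, ?_, ?_⟩
      · rw [List.flatten_cons, hL, ← List.map_append, List.range'_append_1, hd]
      · simp only [List.mem_cons, forall_eq_or_imp, List.mem_map]
        refine ⟨⟨blockLetter k n s, ?_⟩, hconst⟩
        rintro _ ⟨i, hi, rfl⟩
        exact blockLetter_eq_of_mem_range' (by omega) i hi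
      · rw [List.length_cons, mul_add]
        omega

/-- A common subsequence of a type-`n` word and a concatenation of constant blocks is short. -/
theorem length_common_sublist_flatten_le {k n : ℕ} (hk : 0 < k) (hn : 0 < n)
    (L : List (List ℕ)) (hL : ∀ b ∈ L, ∃ a, ∀ x ∈ b, x = a) {v w : List ℕ}
    (hw : IsTypeWord k n w) (hvL : v.Sublist L.flatten) (hvw : v.Sublist w) :
    (k + 1) * v.length ≤ L.flatten.length + w.length + k * n * L.length := by
  induction L generalizing v w with
  | nil =>
    have : v = [] := by simpa using hvL
    simp [this]
  | cons b L ih =>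
    rw [List.flatten_cons, List.sublist_append_iff] at hvL
    obtain ⟨v₁, v₂, rfl, hv₁, hv₂⟩ := hvL
    obtain ⟨u₁, u₂, rfl, hu₁, hu₂⟩ := List.append_sublist_iff.mp hvw
    obtain ⟨a, ha⟩ := hL b List.mem_cons_self
    have hrest := ih (fun b hb => hL b (List.mem_cons_of_mem _ hb))
      (hw.of_infix (List.suffix_append u₁ u₂).isInfix) hv₂ hu₂
    have hcount := (hw.of_infix (List.prefix_append u₁ u₂).isInfix).mul_count_le hk hn a
    have hfull : v₁.count a = v₁.length :=
      List.count_eq_length.mpr fun x hx => (ha x (hv₁.subset hx)).symm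
    have hle := Nat.mul_le_mul_left k (hfull ▸ hu₁.count_le a)
    have hb := hv₁.length_le
    simp only [List.flatten_cons, List.length_append, List.length_cons]
    linarith

/-- **Lemma 1.** If `w1 ∈ S_{n1}` has length `ℓ1` and `w2 ∈ S_{n2}` has length
`ℓ2`, with `n1 > n2 ≥ 1`, then every common subsequence `v` of `w1` and `w2` satisfies
`|v| ≤ (ℓ1 + ℓ2)/(k+1) + ℓ1·n2/n1 + 2·n2`, stated in cleared-denominator form:
`(k+1)·n1·|v| ≤ n1·(ℓ1 + ℓ2) + (k+1)·ℓ1·n2 + 2·(k+1)·n1·n2`. -/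
theorem common_subseq_type_words_bound (k n1 n2 ℓ1 ℓ2 : ℕ) (hk : 2 ≤ k)
    (hn2 : 1 ≤ n2) (hn : n1 > n2)
    (w1 w2 v : List ℕ)
    (hw1 : IsTypeWord k n1 w1) (hw2 : IsTypeWord k n2 w2)
    (hl1 : w1.length = ℓ1) (hl2 : w2.length = ℓ2)
    (hv1 : v.Sublist w1) (hv2 : v.Sublist w2) :
    (k + 1) * n1 * v.length ≤ n1 * (ℓ1 + ℓ2) + (k + 1) * ℓ1 * n2 + 2 * (k + 1) * n1 * n2 := by
  have hn1 : 0 < n1 := by omega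
  have window_bound : ∀ (s : ℕ) (w1 w2 v : List ℕ),
      w1 = (List.range' s ℓ1).map (blockLetter k n1) → IsTypeWord k n2 w2 → w2.length = ℓ2 →
      v.Sublist w1 → v.Sublist w2 → (k + 1) * n1 * v.length ≤
        n1 * (ℓ1 + ℓ2) + (k + 1) * ℓ1 * n2 + 2 * (k + 1) * n1 * n2 := by
    intro s w1 w2 v hw1 hw2 hl2 hv1 hv2
    obtain ⟨L, hL, hconst, hlen⟩ := exists_constant_blocks k hn1 s ℓ1
    have hbound := length_common_sublist_flatten_le (by omega) hn2 L hconst hw2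
      (by rwa [hL, ← hw1]) hv2
    rw [hL, List.length_map, List.length_range', hl2] at hbound
    have hmod := Nat.mod_lt s hn1
    have hblocks : n1 * L.length ≤ ℓ1 + 2 * n1 := by omega
    calc (k + 1) * n1 * v.length = n1 * ((k + 1) * v.length) := by ring
      _ ≤ n1 * (ℓ1 + ℓ2 + k * n2 * L.length) := Nat.mul_le_mul_left _ hbound
      _ = n1 * (ℓ1 + ℓ2) + k * n2 * (n1 * L.length) := by ring
      _ ≤ n1 * (ℓ1 + ℓ2) + (k + 1) * n2 * (ℓ1 + 2 * n1) := by gcongr; omega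
      _ = _ := by ring
  obtain ⟨s, hs⟩ | ⟨s, hs⟩ := hw1.eq_window_or_reverse_eq_window hn1
  · exact window_bound s w1 w2 v (hl1 ▸ hs) hw2 hl2 hv1 hv2
  · simpa using window_bound s w1.reverse w2.reverse v.reverse (hl1 ▸ hs) hw2.reverse
      (by simpa using hl2) hv1.reverse hv2.reverse
end

section
/- Let k ≥ 2, let n2 ≥ 1, p ≥ 1, ℓ ≥ 1, and set n1 = p·n2. Then the word w1 = (0^{n1} 1^{n1} ⋯ (k−1)^{n1})^{ℓ·n2} is a subsequence of the word w2 = (0^{n2} 1^{n2} ⋯ (k−1)^{n2})^{k·ℓ·n1}. (Note |w1| = k·n1·ℓ·n2 and |w2| = k·|w1|, so the longest common subsequence of w1 and w2 has length exactly (|w1| + |w2|)/(k+1), showing the main term of the upper-bound lemma is sharp.) -/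
theorem List.flatMap_sublist_flatten_replicate {α β : Type*} {f : α → List β} {v : List β} :
    ∀ {l : List α}, (∀ a ∈ l, (f a).Sublist v) →
      (l.flatMap f).Sublist (List.replicate l.length v).flatten
  | [], _ => by simp
  | a :: l, h => by
    rw [List.flatMap_cons, List.length_cons, List.replicate_succ, List.flatten_cons]
    exact (h a List.mem_cons_self).append
      (List.flatMap_sublist_flatten_replicate fun b hb => h b (List.mem_cons_of_mem a hb))

theorem List.Sublist.flatten_replicate {α : Type*} {u v : List α} (h : u.Sublist v) (m : ℕ) :
    (List.replicate m u).flatten.Sublist (List.replicate m v).flatten := by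
  induction m with
  | zero => simp
  | succ m ih =>
    simp only [List.replicate_succ, List.flatten_cons]
    exact h.append ih

theorem List.flatten_replicate_flatten_replicate {α : Type*} (m n : ℕ) (u : List α) :
    (List.replicate m (List.replicate n u).flatten).flatten =
      (List.replicate (m * n) u).flatten := by
  induction m with
  | zero => simp
  | succ m ih =>
    rw [List.replicate_succ, List.flatten_cons, ih, Nat.succ_mul, Nat.add_comm,
      List.replicate_add, List.flatten_append]

theorem replicate_sublist_blockWord {k a : ℕ} (ha : a < k) (n : ℕ) :
    (List.replicate n a).Sublist (blockWord k n) :=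
  List.sublist_flatten_of_mem (List.mem_map.2 ⟨a, List.mem_range.2 ha, rfl⟩)

theorem blockWord_mul_sublist (k p n : ℕ) :
    (blockWord k (p * n)).Sublist (List.replicate (k * p) (blockWord k n)).flatten := by
  have h : ∀ a ∈ List.range k, (List.replicate (p * n) a).Sublist
      (List.replicate p (blockWord k n)).flatten := by
    intro a ha
    have := (replicate_sublist_blockWord (List.mem_range.1 ha) n).flatten_replicate p
    rwa [List.flatten_replicate_replicate] at this
  have := List.flatMap_sublist_flatten_replicate h
  rwa [List.length_range, List.flatten_replicate_flatten_replicate] at this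

/-- **sharpness example.** For `k ≥ 2`, `n2, p, ℓ ≥ 1` and `n1 = p · n2`, the
word `w1 = (0^{n1} 1^{n1} ⋯ (k-1)^{n1})^{ℓ·n2}` is a subsequence of
`w2 = (0^{n2} 1^{n2} ⋯ (k-1)^{n2})^{k·ℓ·n1}`. -/
theorem block_power_sublist (k n1 n2 p ℓ : ℕ) (hk : 2 ≤ k)
    (hn2 : 1 ≤ n2) (hp : 1 ≤ p) (hℓ : 1 ≤ ℓ) (hn1 : n1 = p * n2) :
    (List.replicate (ℓ * n2) (blockWord k n1)).flatten.Sublist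
      (List.replicate (k * ℓ * n1) (blockWord k n2)).flatten := by
  have h := (blockWord_mul_sublist k p n2).flatten_replicate (ℓ * n2)
  rw [List.flatten_replicate_flatten_replicate] at h
  rw [hn1, show k * ℓ * (p * n2) = ℓ * n2 * (k * p) by ring]
  exact h
end

section
/- For every integer k ≥ 2 and every real ε > 0, there exist a positive integer n and a word w over the alphabet {0,…,k−1} of length k·n in which every letter occurs exactly n times, such that for every rotation u of w, every subsequence v of u that is a strong antipalindrome satisfies |v| ≤ (2/(k+1) + ε)·k·n. -/
section

open List

/-- Every common subsequence of a factor `p'` of `p` and a factor `q'` of `q` is short compared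
with `p'` and `q'`, up to an additive error `E`. -/
def SparselyMatched (k E : ℕ) (p q : List ℕ) : Prop :=
  ∀ p' q' x : List ℕ, p' <:+: p → q' <:+: q → x <+ p' → x <+ q' →
    (k + 1) * x.length ≤ p'.length + q'.length + E

/-- The reversed letterwise complement of a word over `{0, …, k-1}`. -/
def reverseComplement (k : ℕ) (l : List ℕ) : List ℕ :=
  (l.map (fun a => k - 1 - a)).reverse

/-- The word `(0^m 1^m ⋯ (k-1)^m)^N`. -/
def staircaseWord (k m N : ℕ) : List ℕ :=
  (replicate N ((range k).flatMap (replicate m))).flatten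

lemma SparselyMatched.mono_infix {k E : ℕ} {p q p' q' : List ℕ} (h : SparselyMatched k E p q)
    (hp : p' <:+: p) (hq : q' <:+: q) : SparselyMatched k E p' q' :=
  fun _ _ _ h₁ h₂ => h _ _ _ (h₁.trans hp) (h₂.trans hq)

lemma SparselyMatched.symm {k E : ℕ} {p q : List ℕ} (h : SparselyMatched k E p q) :
    SparselyMatched k E q p := by
  intro p' q' x h₁ h₂ h₃ h₄
  have := h q' p' x h₂ h₁ h₄ h₃
  omega

/-- A common subsequence of two concatenations of sparsely matched pieces is short. -/
lemma length_le_of_sublist_flatten {k E : ℕ} :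
    ∀ (s : ℕ) (P Q : List (List ℕ)) (x : List ℕ), P.length + Q.length = s →
      (∀ p ∈ P, ∀ q ∈ Q, SparselyMatched k E p q) → x <+ P.flatten → x <+ Q.flatten →
      (k + 1) * x.length ≤ P.flatten.length + Q.flatten.length + s * E := by
  intro s
  induction s with
  | zero =>
    intro P Q x hs _ hP _
    obtain rfl : P = [] := List.length_eq_zero_iff.1 (by omega)
    simp only [flatten_nil, sublist_nil] at hP
    simp [hP]
  | succ s ih =>
    intro P Q x hs hPQ hP hQ
    rcases P with _ | ⟨p, P⟩
    · simp only [flatten_nil, sublist_nil] at hP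
      simp [hP]
    rcases Q with _ | ⟨q, Q⟩
    · simp only [flatten_nil, sublist_nil] at hQ
      simp [hQ]
    simp only [length_cons] at hs
    rw [flatten_cons] at hP hQ
    obtain ⟨x₁, x₂, rfl, hx₁, hx₂⟩ := sublist_append_iff.1 hP
    obtain ⟨y₁, y₂, hxy, hy₁, hy₂⟩ := sublist_append_iff.1 hQ
    rcases append_eq_append_iff.1 hxy with ⟨z, rfl, rfl⟩ | ⟨z, rfl, rfl⟩
    · obtain ⟨q₁, q₂, rfl, hq₁, hq₂⟩ := append_sublist_iff.1 hy₁
      have h₁ := hPQ p mem_cons_self (q₁ ++ q₂) mem_cons_self p q₁ x₁ infix_rfl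
        (prefix_append _ _).isInfix hx₁ hq₁
      have h₂ := ih P (q₂ :: Q) (z ++ y₂) (by simp only [length_cons]; omega) (by
        intro a ha b hb
        rcases mem_cons.1 hb with rfl | hb
        · exact (hPQ a (mem_cons_of_mem _ ha) _ mem_cons_self).mono_infix infix_rfl
            (suffix_append _ _).isInfix
        · exact hPQ a (mem_cons_of_mem _ ha) b (mem_cons_of_mem _ hb)) hx₂ (by
        rw [flatten_cons]; exact hq₂.append hy₂)
      simp only [flatten_cons, length_append] at h₂ ⊢
      linarith
    · obtain ⟨p₁, p₂, rfl, hp₁, hp₂⟩ := append_sublist_iff.1 hx₁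
      have h₁ := hPQ (p₁ ++ p₂) mem_cons_self q mem_cons_self p₁ q y₁
        (prefix_append _ _).isInfix infix_rfl hp₁ hy₁
      have h₂ := ih (p₂ :: P) Q (z ++ x₂) (by simp only [length_cons]; omega) (by
        intro a ha b hb
        rcases mem_cons.1 ha with rfl | ha
        · exact (hPQ _ mem_cons_self b (mem_cons_of_mem _ hb)).mono_infix
            (suffix_append _ _).isInfix infix_rfl
        · exact hPQ a (mem_cons_of_mem _ ha) b (mem_cons_of_mem _ hb)) (by
        rw [flatten_cons]; exact hp₂.append hx₂) hy₂
      simp only [flatten_cons, length_append] at h₂ ⊢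
      linarith

/-- Cutting a concatenation in two cuts at most one of its pieces; the left part of the cut piece
is returned separately as `r`. -/
lemma exists_split_of_flatten_eq_append {R : List ℕ → List ℕ → Prop}
    (hR : ∀ p q p' q', p' <:+: p → q' <:+: q → R p q → R p' q')
    {L : List (List ℕ)} (hL : L.Pairwise R) {a d : List ℕ} (h : L.flatten = a ++ d) :
    ∃ (A : List (List ℕ)) (r : List ℕ) (D : List (List ℕ)), a = A.flatten ++ r ∧ d = D.flatten ∧
      (∀ p ∈ A, ∀ q ∈ D, R p q) ∧ D.Pairwise R ∧ (r = [] ∨ ∃ l ∈ L, r <:+: l) ∧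
      (∀ p ∈ A, p ∈ L) ∧ (∀ p ∈ D, ∃ l ∈ L, p <:+: l) ∧ A.length + D.length = L.length := by
  rcases flatten_eq_append_iff.1 h with ⟨A, D, rfl, rfl, rfl⟩ | ⟨A, r, c, cs, D, rfl, rfl, rfl⟩
  · obtain ⟨_, hD, hAD⟩ := pairwise_append.1 hL
    exact ⟨A, [], D, by simp, rfl, hAD, hD, Or.inl rfl,
      fun p hp => by simp [hp], fun p hp => ⟨p, by simp [hp], infix_rfl⟩, by simp⟩
  · obtain ⟨_, hD, hAD⟩ := pairwise_append.1 hL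
    obtain ⟨hc, hD⟩ := pairwise_cons.1 hD
    have hsuff : (c :: cs) <:+: r ++ c :: cs := (suffix_append _ _).isInfix
    refine ⟨A, r, (c :: cs) :: D, rfl, by simp, ?_, ?_, Or.inr ⟨r ++ c :: cs, by simp,
      (prefix_append _ _).isInfix⟩, fun p hp => by simp [hp], ?_, by simp⟩
    · intro p hp q hq
      rcases mem_cons.1 hq with rfl | hq
      · exact hR _ _ _ _ infix_rfl hsuff (hAD p hp _ mem_cons_self)
      · exact hAD p hp q (mem_cons_of_mem _ hq)
    · exact pairwise_cons.2 ⟨fun q hq => hR _ _ _ _ hsuff infix_rfl (hc q hq), hD⟩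
    · intro p hp
      rcases mem_cons.1 hp with rfl | hp
      · exact ⟨_, by simp, hsuff⟩
      · exact ⟨p, by simp [hp], infix_rfl⟩

@[simp]
lemma length_reverseComplement (k : ℕ) (l : List ℕ) :
    (reverseComplement k l).length = l.length := by
  simp [reverseComplement]

lemma reverseComplement_append (k : ℕ) (l l' : List ℕ) :
    reverseComplement k (l ++ l') = reverseComplement k l' ++ reverseComplement k l := by
  simp [reverseComplement]

lemma reverseComplement_flatten (k : ℕ) (L : List (List ℕ)) :
    reverseComplement k L.flatten = (L.map (reverseComplement k)).reverse.flatten := by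
  induction L with
  | nil => rfl
  | cons l L ih => simp [reverseComplement_append, ih]

lemma reverseComplement_infix {k : ℕ} {l l' : List ℕ} (h : l <:+: l') :
    reverseComplement k l <:+: reverseComplement k l' :=
  reverse_infix.2 (h.map _)

/-- If a word is a concatenation of pieces that are pairwise sparsely matched with each other's
reversed complements, then an arc of the circular word and the complementary arc share no long
subsequence up to reversed complement. -/
lemma length_le_of_sublist_arcs {k E B : ℕ} {L : List (List ℕ)}
    (hL : L.Pairwise fun p q => SparselyMatched k E p (reverseComplement k q) ∧
      SparselyMatched k E q (reverseComplement k p))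
    (hB : ∀ l ∈ L, l.length ≤ B) {a b c x y : List ℕ} (h : L.flatten = a ++ (b ++ c))
    (hx : x <+ b) (hy : y <+ c ++ a) (hxy : x = reverseComplement k y) :
    (k + 1) * x.length ≤ L.flatten.length + L.length * E + 2 * (k + 1) * B := by
  have hR : ∀ p q p' q' : List ℕ, p' <:+: p → q' <:+: q →
      (SparselyMatched k E p (reverseComplement k q) ∧
        SparselyMatched k E q (reverseComplement k p)) →
      (SparselyMatched k E p' (reverseComplement k q') ∧
        SparselyMatched k E q' (reverseComplement k p')) := fun p q p' q' hp hq hpq =>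
    ⟨hpq.1.mono_infix hp (reverseComplement_infix hq),
      hpq.2.mono_infix hq (reverseComplement_infix hp)⟩
  obtain ⟨A, r, D, rfl, hD, hAD, hDD, hr, -, hDL, hlen⟩ := exists_split_of_flatten_eq_append hR hL h
  obtain ⟨C, s, F, rfl, rfl, hCF, -, hs, hCD, -, hlen'⟩ :=
    exists_split_of_flatten_eq_append hR hDD hD.symm
  have hrB : r.length ≤ B := by
    rcases hr with rfl | ⟨l, hl, hrl⟩
    · simp
    · exact hrl.length_le.trans (hB l hl)
  have hsB : s.length ≤ B := by
    rcases hs with rfl | ⟨l, hl, hsl⟩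
    · simp
    · obtain ⟨l', hl', hll'⟩ := hDL l hl
      exact (hsl.trans hll').length_le.trans (hB l' hl')
  obtain ⟨x₁, x₂, rfl, hx₁, hx₂⟩ := sublist_append_iff.1 hx
  have hx' : x₁ ++ x₂ <+ reverseComplement k r ++
      ((F ++ A).map (reverseComplement k)).reverse.flatten := by
    rw [hxy, ← reverseComplement_flatten, ← reverseComplement_append, flatten_append,
      append_assoc]
    exact (hy.map _).reverse
  obtain ⟨z₁, z₂, hz, hz₁, hz₂⟩ := sublist_append_iff.1 ((sublist_append_left x₁ x₂).trans hx')
  subst hz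
  have key := length_le_of_sublist_flatten (k := k) (E := E) _ C
    ((F ++ A).map (reverseComplement k)).reverse z₂ rfl (by
      intro p hp q hq
      simp only [mem_reverse, mem_map, mem_append] at hq
      obtain ⟨q, hq | hq, rfl⟩ := hq
      · exact (hCF p hp q hq).1
      · exact (hAD q hq p (hCD p hp)).2) ((sublist_append_right _ _).trans hx₁) hz₂
  rw [← reverseComplement_flatten] at key
  have h₁ := hz₁.length_le
  have h₂ := hx₂.length_le
  simp only [length_reverseComplement, length_append, flatten_append, length_reverse,
    length_map] at key h₁ h
  rw [h]
  simp only [length_append]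
  have h₃ : C.length + (F.length + A.length) = L.length := by omega
  rw [h₃] at key
  have h₄ : (k + 1) * z₁.length ≤ (k + 1) * B := Nat.mul_le_mul_left _ (h₁.trans hrB)
  have h₅ : (k + 1) * x₂.length ≤ (k + 1) * B := Nat.mul_le_mul_left _ (h₂.trans hsB)
  linarith

lemma count_block {k m c : ℕ} (hc : c < k) :
    ((range k).flatMap (replicate m)).count c = m := by
  rw [count_flatMap, sum_map_eq_nsmul_single c]
  · simp [count_eq_one_of_mem nodup_range (mem_range.2 hc)]
  · intro a ha _
    simp [count_replicate, ha]

lemma length_block (k m : ℕ) : ((range k).flatMap (replicate m)).length = k * m := by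
  simp

lemma length_staircaseWord (k m N : ℕ) : (staircaseWord k m N).length = k * (m * N) := by
  simp [staircaseWord]
  ring

lemma count_staircaseWord {k m N c : ℕ} (hc : c < k) :
    (staircaseWord k m N).count c = m * N := by
  simp [staircaseWord, count_flatten, count_block hc, mul_comm]

lemma reverseComplement_staircaseWord (k m N : ℕ) :
    reverseComplement k (staircaseWord k m N) = staircaseWord k m N := by
  have hblock : reverseComplement k ((range k).flatMap (replicate m)) =
      (range k).flatMap (replicate m) := by
    have hrange : (range k).map (fun a => k - 1 - a) = (range k).reverse := by
      apply ext_getElem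
      · simp
      · intro i h₁ h₂
        simp
    rw [reverseComplement, map_flatMap, reverse_flatMap]
    have hrev : (range k).reverse.map (fun a => k - 1 - a) = range k := by
      rw [map_reverse, hrange, reverse_reverse]
    conv_rhs => rw [← hrev, flatMap_map]
    congr 1
    funext a
    simp
  rw [staircaseWord, reverseComplement_flatten]
  simp [hblock]

lemma prefix_discrepancy {k c : ℕ} {P : List ℕ} (hP : k * P.count c = P.length) (N : ℕ) :
    ∀ a : List ℕ, a <+: (replicate N P).flatten →
      k * a.count c ≤ a.length + P.length ∧ a.length ≤ k * a.count c + P.length := by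
  induction N with
  | zero =>
    intro a ha
    simp only [replicate_zero, flatten_nil, prefix_nil] at ha
    simp [ha]
  | succ N ih =>
    rintro a ⟨t, ht⟩
    rw [replicate_succ, flatten_cons] at ht
    rcases append_eq_append_iff.1 ht with ⟨z, hz, -⟩ | ⟨z, rfl, hz⟩
    · have h₁ : a.count c ≤ P.count c := by rw [hz, count_append]; omega
      have h₂ : a.length ≤ P.length := by rw [hz, length_append]; omega
      have h₃ := Nat.mul_le_mul_left k h₁
      omega
    · have := ih z ⟨t, hz.symm⟩
      rw [count_append, length_append, mul_add]
      omega

lemma count_infix_staircaseWord {k m N c : ℕ} (hc : c < k) {b : List ℕ}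
    (hb : b <:+: staircaseWord k m N) : k * b.count c ≤ b.length + 2 * (k * m) := by
  obtain ⟨s, t, hst⟩ := hb
  have hP : k * ((range k).flatMap (replicate m)).count c =
      ((range k).flatMap (replicate m)).length := by rw [count_block hc, length_block]
  have h₁ := prefix_discrepancy hP N (s ++ b) ⟨t, hst⟩
  have h₂ := prefix_discrepancy hP N s ⟨b ++ t, by rw [← append_assoc]; exact hst⟩
  rw [count_append, length_append, mul_add, length_block] at h₁
  rw [length_block] at h₂
  omega

/-- A word with few runs has few letters in common with a factor of a finely staircased word. -/
lemma length_le_of_sublist_runs {k m N : ℕ} (R : List (List ℕ))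
    (hR : ∀ l ∈ R, ∃ c < k, ∀ a ∈ l, a = c) :
    ∀ x q : List ℕ, q <:+: staircaseWord k m N → x <+ R.flatten → x <+ q →
      k * x.length ≤ q.length + R.length * (2 * (k * m)) := by
  induction R with
  | nil =>
    intro x q _ hx _
    simp only [flatten_nil, sublist_nil] at hx
    simp [hx]
  | cons l R ih =>
    intro x q hq hx hxq
    rw [flatten_cons] at hx
    obtain ⟨x₁, x₂, rfl, hx₁, hx₂⟩ := sublist_append_iff.1 hx
    obtain ⟨q₁, q₂, rfl, hq₁, hq₂⟩ := append_sublist_iff.1 hxq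
    obtain ⟨c, hc, hlc⟩ := hR l mem_cons_self
    have h₁ := ih (fun l hl => hR l (mem_cons_of_mem _ hl)) x₂ q₂
      ((suffix_append _ _).isInfix.trans hq) hx₂ hq₂
    have h₂ := count_infix_staircaseWord hc ((prefix_append q₁ q₂).isInfix.trans hq)
    have h₃ : x₁.count c = x₁.length :=
      count_eq_length.2 fun a ha => (hlc a (hx₁.subset ha)).symm
    have h₄ := Nat.mul_le_mul_left k (hq₁.count_le c)
    rw [h₃] at h₄
    simp only [length_append, length_cons]
    linarith

lemma sparselyMatched_staircaseWord {k m N m' N' E : ℕ} (hE : N' * k * (2 * (k * m)) ≤ E) :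
    SparselyMatched k E (staircaseWord k m' N') (staircaseWord k m N) := by
  intro p' q' x hp hq hxp hxq
  have h := length_le_of_sublist_runs (k := k) (m := m) (N := N)
    ((replicate N' ((range k).map (replicate m'))).flatten) (by
      intro l hl
      simp only [mem_flatten, mem_replicate] at hl
      obtain ⟨_, ⟨-, rfl⟩, hl⟩ := hl
      simp only [mem_map, mem_range] at hl
      obtain ⟨c, hc, rfl⟩ := hl
      exact ⟨c, hc, fun a ha => eq_of_mem_replicate ha⟩) x q' hq (by
      rw [flatten_flatten, map_replicate, ← flatMap_def]
      exact hxp.trans hp.sublist) hxq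
  have hlen : ((replicate N' ((range k).map (replicate m'))).flatten).length = N' * k := by simp
  rw [hlen] at h
  have := hxp.length_le
  linarith

lemma pairwise_sparselyMatched (k q M : ℕ) (hq : 0 < q) :
    ((range M).map fun i => staircaseWord k (q ^ i) (q ^ (M - i))).Pairwise fun a b =>
      SparselyMatched k (2 * k ^ 2 * q ^ (M - 1)) a (reverseComplement k b) ∧
      SparselyMatched k (2 * k ^ 2 * q ^ (M - 1)) b (reverseComplement k a) := by
  rw [pairwise_map]
  refine (pairwise_lt_range (n := M)).imp_of_mem fun {i j} _ hj hij => ?_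
  rw [mem_range] at hj
  simp only [reverseComplement_staircaseWord]
  have key : SparselyMatched k (2 * k ^ 2 * q ^ (M - 1)) (staircaseWord k (q ^ j) (q ^ (M - j)))
      (staircaseWord k (q ^ i) (q ^ (M - i))) := by
    apply sparselyMatched_staircaseWord
    calc q ^ (M - j) * k * (2 * (k * q ^ i)) = 2 * k ^ 2 * q ^ (M - j + i) := by ring
      _ ≤ _ := Nat.mul_le_mul_left _ (Nat.pow_le_pow_right hq (by omega))
  exact ⟨key.symm, key⟩

/-- A strong antipalindrome consists of a word, at most one central letter, and the reversed
complement of the word. -/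
lemma exists_halves_of_antipalindrome {k : ℕ} {v : List ℕ}
    (hv : v.reverse = v.map (fun a => k - 1 - a)) :
    ∃ x mid y : List ℕ, v = x ++ (mid ++ y) ∧ mid.length ≤ 1 ∧ x.length = y.length ∧
      x = reverseComplement k y ∧ y = reverseComplement k x := by
  obtain ⟨x, mid, y, rfl, hmid, hlen⟩ : ∃ x mid y : List ℕ, v = x ++ (mid ++ y) ∧
      mid.length ≤ 1 ∧ x.length = y.length :=
    ⟨v.take (v.length / 2), (v.drop (v.length / 2)).take (v.length % 2),
      (v.drop (v.length / 2)).drop (v.length % 2), by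
        rw [take_append_drop, take_append_drop], by
        rw [length_take]; omega, by
        simp only [length_take, length_drop]; omega⟩
  simp only [reverse_append, map_append, append_assoc] at hv
  obtain ⟨h₁, h₂⟩ := append_inj hv (by simp [hlen])
  obtain ⟨-, h₃⟩ := append_inj h₂ (by simp)
  exact ⟨x, mid, y, rfl, hmid, hlen, by rw [reverseComplement, ← h₃, reverse_reverse],
    by rw [reverseComplement, ← h₁, reverse_reverse]⟩

/-- The bound on strong antipalindromes in all rotations of a concatenation of pieces. -/
lemma length_antipalindrome_le {k E B : ℕ} {L : List (List ℕ)}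
    (hL : L.Pairwise fun p q => SparselyMatched k E p (reverseComplement k q) ∧
      SparselyMatched k E q (reverseComplement k p))
    (hB : ∀ l ∈ L, l.length ≤ B) {i : ℕ} {v : List ℕ} (hvs : v <+ L.flatten.rotate i)
    (hv : v.reverse = v.map (fun a => k - 1 - a)) :
    (k + 1) * v.length ≤
      2 * (L.flatten.length + L.length * E + 2 * (k + 1) * B) + (k + 1) := by
  obtain ⟨x, mid, y, rfl, hmid, hlen, hxy, hyx⟩ := exists_halves_of_antipalindrome hv
  have hx : (k + 1) * x.length ≤ L.flatten.length + L.length * E + 2 * (k + 1) * B := by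
    rw [rotate_eq_drop_append_take_mod] at hvs
    obtain ⟨u₁, u₂, hu, hu₁, hu₂⟩ := append_sublist_iff.1 hvs
    have hy : y <+ u₂ := (sublist_append_right _ _).trans hu₂
    have hw := take_append_drop (i % L.flatten.length) L.flatten
    rcases append_eq_append_iff.1 hu with ⟨z, h₁, h₂⟩ | ⟨z, h₁, h₂⟩
    · rw [h₂, append_assoc] at hw
      rw [hlen]
      rw [h₁] at hu₁
      exact length_le_of_sublist_arcs hL hB hw.symm hy hu₁ hyx
    · rw [h₁] at hw
      rw [h₂] at hy
      exact length_le_of_sublist_arcs hL hB hw.symm hu₁ hy hxy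
  have h₁ := Nat.mul_le_mul_left (k + 1) hmid
  simp only [length_append]
  rw [← hlen]
  linarith

end

/-- **Theorem 1, strongly antipalindromic part.** For every `k ≥ 2` and
`ε > 0`, there is a circular word over `{0, …, k-1}` with each letter occurring exactly `n`
times (length `k·n`) such that every strongly antipalindromic subsequence of every rotation
has length at most `(2/(k+1) + ε)·k·n`.  A word `v` is a strong antipalindrome if
`v.reverse = v.map (fun a => k - 1 - a)`. -/
theorem strong_antipalindromic_subseq_upper_bound (k : ℕ) (hk : 2 ≤ k) (ε : ℝ) (hε : 0 < ε) :
    ∃ (n : ℕ), 0 < n ∧ ∃ w : List ℕ,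
      w.length = k * n ∧ (∀ a < k, w.count a = n) ∧
      ∀ (i : ℕ) (v : List ℕ), v.Sublist (w.rotate i) →
        v.reverse = v.map (fun a => k - 1 - a) →
        (v.length : ℝ) ≤ (2 / (k + 1) + ε) * (k * n) := by
  obtain ⟨q, hq⟩ := exists_nat_gt (24 / ε)
  obtain ⟨M, hM⟩ := exists_nat_gt (10 / ε)
  have hq0 : 0 < q := by
    have : (0 : ℝ) < q := lt_trans (by positivity) hq
    exact_mod_cast this
  have hM0 : 0 < M := by
    have : (0 : ℝ) < M := lt_trans (by positivity) hM
    exact_mod_cast this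
  set L := (List.range M).map fun i => staircaseWord k (q ^ i) (q ^ (M - i)) with hLdef
  have hpow : ∀ i ∈ List.range M, q ^ i * q ^ (M - i) = q ^ M := by
    intro i hi
    rw [← pow_add, Nat.add_sub_cancel' (List.mem_range.1 hi).le]
  have hlen : L.flatten.length = k * (M * q ^ M) := by
    rw [List.length_flatten, hLdef, List.map_map, List.map_congr_left (g := fun _ => k * q ^ M)]
    · simp; ring
    · intro i hi
      simp [length_staircaseWord, hpow i hi]
  refine ⟨M * q ^ M, by positivity, L.flatten, hlen, ?_, ?_⟩
  · intro a ha
    rw [List.count_flatten, hLdef, List.map_map, List.map_congr_left (g := fun _ => q ^ M)]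
    · simp
    · intro i hi
      simp [count_staircaseWord ha, hpow i hi]
  · intro i v hvs hv
    have hB : ∀ l ∈ L, l.length ≤ k * q ^ M := by
      intro l hl
      obtain ⟨i, hi, rfl⟩ := List.mem_map.1 hl
      rw [length_staircaseWord, hpow i hi]
    have key := length_antipalindrome_le (pairwise_sparselyMatched k q M hq0) hB hvs hv
    rw [← hLdef, hlen] at key
    have hLlen : L.length = M := by simp [hLdef]
    rw [hLlen] at key
    have hq' : 24 < ε * q := by rw [div_lt_iff₀ hε] at hq; linarith
    have hM' : 10 < ε * M := by rw [div_lt_iff₀ hε] at hM; linarith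
    have hsucc : q ^ M = q ^ (M - 1) * q := by rw [← pow_succ, Nat.sub_add_cancel hM0]
    have hone : 1 ≤ q ^ M := Nat.one_le_pow _ _ hq0
    have keyR : ((k : ℝ) + 1) * v.length ≤ 2 * (k * (M * (q : ℝ) ^ M) +
        M * (2 * k ^ 2 * (q : ℝ) ^ (M - 1)) + 2 * (k + 1) * (k * (q : ℝ) ^ M)) + (k + 1) := by
      exact_mod_cast key
    have hsuccR : (q : ℝ) ^ M = (q : ℝ) ^ (M - 1) * q := by exact_mod_cast hsucc
    have honeR : (1 : ℝ) ≤ (q : ℝ) ^ M := by exact_mod_cast hone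
    have hkR : (2 : ℝ) ≤ k := by exact_mod_cast hk
    have hMR : (0 : ℝ) < M := by exact_mod_cast hM0
    have hTR : (0 : ℝ) < (q : ℝ) ^ (M - 1) := by
      have : (0 : ℝ) < q := by exact_mod_cast hq0
      positivity
    have e₁ : 4 * M * k ^ 2 * (q : ℝ) ^ (M - 1) ≤
        (k + 1) * (ε / 2 * (k * (M * (q : ℝ) ^ M))) := by
      have h : 24 * (M * k * (q : ℝ) ^ (M - 1) * (k + 1)) ≤
          ε * q * (M * k * (q : ℝ) ^ (M - 1) * (k + 1)) :=
        mul_le_mul_of_nonneg_right hq'.le (by positivity)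
      have h' : 0 < M * k * (q : ℝ) ^ (M - 1) := by positivity
      rw [hsuccR]
      nlinarith
    have e₂ : 4 * (k + 1) * (k * (q : ℝ) ^ M) + (k + 1) ≤
        (k + 1) * (ε / 2 * (k * (M * (q : ℝ) ^ M))) := by
      have h : 10 * (k * (q : ℝ) ^ M * (k + 1)) ≤ ε * M * (k * (q : ℝ) ^ M * (k + 1)) :=
        mul_le_mul_of_nonneg_right hM'.le (by positivity)
      have h' : (1 : ℝ) ≤ k * (q : ℝ) ^ M := by nlinarith
      have h'' := mul_le_mul_of_nonneg_right h' (by positivity : (0 : ℝ) ≤ k + 1)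
      nlinarith
    have hk1 : (0 : ℝ) < k + 1 := by positivity
    refine le_of_mul_le_mul_left ?_ hk1
    push_cast
    have hsplit : ((k : ℝ) + 1) * ((2 / (k + 1) + ε) * (k * (M * (q : ℝ) ^ M))) =
        2 * (k * (M * (q : ℝ) ^ M)) + (k + 1) * (ε * (k * (M * (q : ℝ) ^ M))) := by
      field_simp
    rw [hsplit]
    linarith
end

section
/- Every binary word w of length n that contains no three consecutive equal letters (i.e. no infix of the form a·a·a) has a palindromic subsequence v with 3·|v| ≥ 2·(n − 2). -/
/-- A word without three consecutive equal letters and with first letter `a` is a run of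
one or two letters `a` followed by a word that does not start with `a`. -/
theorem exists_first_run_of_no_triple {α : Type*} {w : List α} {a : α}
    (hw : ∀ x, ¬ [x, x, x] <:+: w) (ha : w.head? = some a) :
    ∃ i m, (i = 1 ∨ i = 2) ∧ w = List.replicate i a ++ m ∧ m.head? ≠ some a := by
  match w, ha with
  | [x], ha => exact ⟨1, [], by simp_all⟩
  | [x, y], ha =>
    by_cases h : y = a
    · exact ⟨2, [], by simp_all [List.replicate]⟩
    · exact ⟨1, [y], by simp_all⟩
  | x :: y :: z :: t, ha =>
    obtain rfl : x = a := by simpa using ha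
    by_cases h : y = x
    · subst h
      refine ⟨2, z :: t, by simp, by simp [List.replicate], ?_⟩
      intro hz
      obtain rfl : z = y := by simpa using hz
      exact hw z ⟨[], t, by simp⟩
    · exact ⟨1, y :: z :: t, by simp_all⟩

/-- A binary word without three consecutive equal letters whose first and last letters agree
has a palindromic subsequence of at least two thirds of its length. -/
theorem exists_palindrome_sublist_of_head_eq_getLast (w : List (Fin 2)) (a : Fin 2)
    (hw : ∀ x, ¬ [x, x, x] <:+: w) (hhead : w.head? = some a) (hlast : w.getLast? = some a) :
    ∃ v : List (Fin 2), v.Sublist w ∧ v.reverse = v ∧ 2 * w.length ≤ 3 * v.length := by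
  induction hn : w.length using Nat.strong_induction_on generalizing w a with
  | _ n ih =>
    subst hn
    obtain ⟨i, m, hi, rfl, hm⟩ := exists_first_run_of_no_triple hw hhead
    rcases m.eq_nil_or_concat' with rfl | ⟨m', c, rfl⟩
    · exact ⟨List.replicate i a, by simp, by simp, by simp; omega⟩
    obtain rfl : c = a := by simpa [List.getLast?_append] using hlast
    have hrev : ∀ x, ¬ [x, x, x] <:+: (m' ++ [c]).reverse := by
      intro x hx
      apply hw x
      have := List.reverse_infix.mpr hx
      rw [List.reverse_reverse] at this
      exact List.IsInfix.trans (by simpa using this) (List.suffix_append _ _).isInfix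
    obtain ⟨j, r, hj, hr, hrc⟩ := exists_first_run_of_no_triple (a := c) hrev (by simp)
    have hm' : m' ++ [c] = r.reverse ++ List.replicate j c := by
      have := congrArg List.reverse hr
      simpa using this
    rw [hm'] at hw hm ⊢
    rcases r.eq_nil_or_concat' with rfl | ⟨s, d, rfl⟩
    · rcases hj with rfl | rfl <;> simp [List.replicate] at hm
    have hd : d ≠ c := by simpa using hm
    have hlast' : (s ++ [d]).head? = some d := by
      cases hs : (s ++ [d]).head? with
      | none => simp at hs
      | some e =>
        rw [hs] at hrc
        have : e ≠ c := by simpa using hrc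
        congr 1
        omega
    obtain ⟨v, hv, hpal, hlen⟩ := ih _ (by simp [hm']; omega) (s ++ [d]).reverse d
      (fun x hx => hw x (hx.trans ⟨List.replicate i c, List.replicate j c, by simp⟩))
      (by simp) (by rw [List.getLast?_reverse]; exact hlast') rfl
    refine ⟨List.replicate (min i j) c ++ (v ++ List.replicate (min i j) c), ?_, ?_, ?_⟩
    · exact ((List.replicate_sublist_replicate c).mpr (by omega)).append
        (hv.append ((List.replicate_sublist_replicate c).mpr (by omega)))
    · simp [hpal]
    · simp only [List.length_append, List.length_replicate, List.length_reverse] at hlen ⊢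
      omega

/-- Every binary word `w` of length `n` with no three consecutive equal
letters has a palindromic subsequence `v` with `3 * |v| ≥ 2 * (n - 2)`. -/
theorem palindromic_subseq_no_triple (w : List (Fin 2)) (n : ℕ) (hn : w.length = n)
    (hno3 : ¬ ∃ (u v : List (Fin 2)) (a : Fin 2), w = u ++ [a, a, a] ++ v) :
    ∃ v : List (Fin 2), v.Sublist w ∧ v.reverse = v ∧ 3 * v.length ≥ 2 * (n - 2) := by
  have hw : ∀ x, ¬ [x, x, x] <:+: w := fun x ⟨u, v, h⟩ => hno3 ⟨u, v, x, h.symm⟩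
  subst hn
  rcases w.eq_nil_or_concat' with rfl | ⟨t, b, ht⟩
  · exact ⟨[], by simp⟩
  have hlast : w.getLast? = some b := by simp [ht]
  obtain ⟨a, ha⟩ : ∃ a, w.head? = some a := by
    cases hs : w.head? with
    | none => simp_all
    | some e => exact ⟨e, rfl⟩
  by_cases hab : a = b
  · subst hab
    obtain ⟨v, hv, hpal, hlen⟩ := exists_palindrome_sublist_of_head_eq_getLast w a hw ha hlast
    exact ⟨v, hv, hpal, by omega⟩
  obtain ⟨i, m, hi, rfl, hm⟩ := exists_first_run_of_no_triple hw ha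
  have hsuf := List.suffix_append (List.replicate i a) m
  cases m with
  | nil =>
    rcases hi with rfl | rfl <;> simp [List.replicate, hab] at hlast
  | cons c m =>
    have hc : c ≠ a := by simpa using hm
    obtain rfl : c = b := by omega
    obtain ⟨v, hv, hpal, hlen⟩ := exists_palindrome_sublist_of_head_eq_getLast (c :: m) c
      (fun x hx => hw x (hx.trans hsuf.isInfix)) (by simp)
      (by rw [List.getLast?_append_of_ne_nil _ (by simp)] at hlast; exact hlast)
    refine ⟨v, hv.trans hsuf.sublist, hpal, ?_⟩
    simp only [List.length_append, List.length_replicate]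
    omega
end

section
/- Every binary word w of length n that contains no three consecutive equal letters (i.e. no infix of the form a·a·a) has an antipalindromic subsequence v with 3·|v| ≥ 2·(n − 2). -/
/-- Enclosing an antipalindrome between two distinct letters gives an antipalindrome. -/
theorem antipalindrome_enclose {a b : Fin 2} (hab : a ≠ b) {v : List (Fin 2)}
    (hv : v.reverse = v.map (fun a => 1 - a)) :
    (a :: (v ++ [b])).reverse = (a :: (v ++ [b])).map (fun a => 1 - a) := by
  have h : b = 1 - a ∧ a = 1 - b := by revert a b; decide
  simp [hv, ← h.1, ← h.2]

/-- Around distinct letters `a`, `b`, a word avoiding cubes has an inner part that cannot both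
start and end with the same square. -/
theorem not_square_prefix_suffix_of_enclosed {a b : Fin 2} (hab : a ≠ b) {x : List (Fin 2)}
    (ha : ∀ c, ¬ [c, c, c] <:+: a :: x) (hb : ∀ c, ¬ [c, c, c] <:+: x ++ [b]) (c : Fin 2) :
    ¬ ([c, c] <+: x ∧ [c, c] <:+ x) := by
  rintro ⟨⟨t, rfl⟩, s, hs⟩
  obtain rfl | rfl : c = a ∨ c = b := by omega
  · exact ha c ⟨[], t, by simp⟩
  · exact hb c ⟨s, [], by simp [← hs]⟩

/-- A cube-free binary word that does not both start and end with the same square has an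
antipalindromic subsequence `v` with `3 * |v| ≥ 2 * (|w| - 1)`. -/
theorem exists_antipalindrome_sublist_of_not_square_ends (w : List (Fin 2))
    (hcube : ∀ c, ¬ [c, c, c] <:+: w) (hends : ∀ c, ¬ ([c, c] <+: w ∧ [c, c] <:+ w)) :
    ∃ v : List (Fin 2), v.Sublist w ∧ v.reverse = v.map (fun a => 1 - a) ∧
      2 * w.length ≤ 3 * v.length + 2 := by
  induction hn : w.length using Nat.strong_induction_on generalizing w with
  | _ n ih =>
  subst hn
  /- It suffices to write `w`, up to at most one deleted letter, as an inner factor `x`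
  enclosed between two distinct letters. -/
  have step : ∀ (a b : Fin 2) (x : List (Fin 2)), a ≠ b → a :: x <:+: w → x ++ [b] <:+: w →
      (a :: (x ++ [b])).Sublist w → w.length ≤ x.length + 3 →
      ∃ v : List (Fin 2), v.Sublist w ∧ v.reverse = v.map (fun a => 1 - a) ∧
        2 * w.length ≤ 3 * v.length + 2 := by
    intro a b x hab hax hxb hsub hlen
    have hlt := hsub.length_le
    simp only [List.length_cons, List.length_append, List.length_nil] at hlt
    obtain ⟨v, hvx, hv, hvlen⟩ := ih x.length (by omega) x
      (fun c hc => hcube c ((hc.trans (List.infix_cons (List.infix_refl x))).trans hax))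
      (not_square_prefix_suffix_of_enclosed hab (fun c hc => hcube c (hc.trans hax))
        (fun c hc => hcube c (hc.trans hxb))) rfl
    refine ⟨a :: (v ++ [b]), ((hvx.append_right [b]).cons_cons a).trans hsub,
      antipalindrome_enclose hab hv, ?_⟩
    simp only [List.length_cons, List.length_append, List.length_nil]
    omega
  rcases w with _ | ⟨a, u⟩
  · exact ⟨[], by simp⟩
  rcases List.eq_nil_or_concat u with rfl | ⟨u, b, rfl⟩
  · exact ⟨[], by simp⟩
  rw [List.concat_eq_append] at *
  by_cases hab : a = b
  · subst hab
    by_cases hstart : [a, a] <+: a :: (u ++ [a])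
    · have hend : ¬ [a, a] <:+ a :: (u ++ [a]) := fun h => hends a ⟨hstart, h⟩
      rcases List.eq_nil_or_concat u with rfl | ⟨x, d, rfl⟩
      · exact absurd (List.suffix_refl _) hend
      rw [List.concat_eq_append] at *
      have had : a ≠ d := by
        rintro rfl
        exact hend ⟨a :: x, by simp⟩
      exact step a d x had ⟨[], [d, a], by simp⟩ ⟨[a], [a], by simp⟩ (by simp) (by simp)
    · rcases u with _ | ⟨d, x⟩
      · exact absurd (List.prefix_refl _) hstart
      have hda : d ≠ a := by
        rintro rfl
        exact hstart ⟨x ++ [d], by simp⟩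
      exact step d a x hda ⟨[a], [a], by simp⟩ ⟨[a, d], [], by simp⟩ (by simp) (by simp)
  · exact step a b u hab ⟨[], [b], by simp⟩ ⟨[a], [], by simp⟩ (by simp) (by simp)

/-- Every binary word `w` of length `n` with no three consecutive equal
letters has an antipalindromic subsequence `v` with `3 * |v| ≥ 2 * (n - 2)`.  A binary word
`v` is an antipalindrome if `v.reverse = v.map (fun a => 1 - a)`. -/
theorem antipalindromic_subseq_no_triple (w : List (Fin 2)) (n : ℕ) (hn : w.length = n)
    (hno3 : ¬ ∃ (u v : List (Fin 2)) (a : Fin 2), w = u ++ [a, a, a] ++ v) :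
    ∃ v : List (Fin 2), v.Sublist w ∧ v.reverse = v.map (fun a => 1 - a) ∧
      3 * v.length ≥ 2 * (n - 2) := by
  have hcube : ∀ c, ¬ [c, c, c] <:+: w := fun c ⟨s, t, h⟩ => hno3 ⟨s, t, c, h.symm⟩
  by_cases hends : ∀ c, ¬ ([c, c] <+: w ∧ [c, c] <:+ w)
  · obtain ⟨v, hvw, hv, hlen⟩ := exists_antipalindrome_sublist_of_not_square_ends w hcube hends
    exact ⟨v, hvw, hv, by omega⟩
  · push Not at hends
    obtain ⟨c, ⟨t, rfl⟩, -⟩ := hends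
    obtain ⟨v, hvw, hv, hlen⟩ := exists_antipalindrome_sublist_of_not_square_ends (c :: t)
      (fun e he => hcube e (he.trans ⟨[c], [], by simp⟩)) (by
        rintro e ⟨⟨s, hs⟩, -⟩
        simp only [List.cons_append, List.nil_append, List.cons.injEq] at hs
        obtain ⟨rfl, rfl⟩ := hs
        exact hcube e ⟨[], s, by simp⟩)
    refine ⟨v, hvw.trans (by simp), hv, ?_⟩
    simp only [List.length_cons, List.length_append, List.length_nil] at hn hlen
    omega
end

section
/- Let w be a word of length n over a three-letter alphabet in which no two consecutive letters are equal. Then w has a palindromic subsequence v with 2·|v| ≥ n − 1. -/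
/-- Two pairs of distinct letters of a three-letter alphabet share a letter. -/
theorem exists_common_letter (a b c d : Fin 3) (hab : a ≠ b) (hcd : c ≠ d) :
    ∃ e, (e = a ∨ e = b) ∧ (e = c ∨ e = d) := by
  decide +revert

/-- A list of length at least four consists of a first pair, a middle part and a last pair. -/
theorem List.exists_eq_pair_append_pair {α : Type*} (w : List α) (h : 4 ≤ w.length) :
    ∃ a b u c d, w = [a, b] ++ (u ++ [c, d]) := by
  obtain _ | ⟨a, _ | ⟨b, t⟩⟩ := w
  · simp at h
  · simp at h
  · obtain rfl | ⟨s, d, rfl⟩ := t.eq_nil_or_concat'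
    · simp at h
    · obtain rfl | ⟨u, c, rfl⟩ := s.eq_nil_or_concat'
      · simp at h
      · exact ⟨a, b, u, c, d, by simp⟩

/-- A word over three letters without equal neighbours has a palindromic subsequence of at least
about half its length: a letter common to the first pair and the last pair extends a palindromic
subsequence of the middle part. -/
theorem exists_palindromic_sublist (w : List (Fin 3)) (hw : w.IsChain (· ≠ ·)) :
    ∃ v : List (Fin 3), v.Sublist w ∧ v.reverse = v ∧ w.length ≤ 2 * v.length + 1 := by
  induction w using (measure List.length).wf.induction with | _ w ih
  by_cases h : 4 ≤ w.length
  · obtain ⟨a, b, u, c, d, rfl⟩ := w.exists_eq_pair_append_pair h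
    have hab := List.isChain_pair.1 hw.left_of_append
    have hu := hw.right_of_append.left_of_append
    have hcd := List.isChain_pair.1 hw.right_of_append.right_of_append
    obtain ⟨e, hl, hr⟩ := exists_common_letter a b c d hab hcd
    obtain ⟨v, hvu, hv, hlen⟩ := ih u (by simp [WellFoundedRelation.rel, InvImage]; omega) hu
    refine ⟨[e] ++ (v ++ [e]), ?_, by simp [hv], ?_⟩
    · exact (List.singleton_sublist.2 (by simpa using hl)).append
        (hvu.append (List.singleton_sublist.2 (by simpa using hr)))
    · simp only [List.length_append, List.length_cons, List.length_nil]
      omega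
  · obtain _ | ⟨a, t⟩ := w
    · exact ⟨[], by simp⟩
    · exact ⟨[a], by simp, by simp, by simp at h ⊢; omega⟩

/-- Every word `w` of length `n` over a three-letter alphabet in which no
two consecutive letters are equal has a palindromic subsequence `v` with `2 * |v| ≥ n - 1`. -/
theorem palindromic_subseq_ternary_no_square (w : List (Fin 3)) (n : ℕ) (hn : w.length = n)
    (hchain : w.Chain' (· ≠ ·)) :
    ∃ v : List (Fin 3), v.Sublist w ∧ v.reverse = v ∧ 2 * v.length ≥ n - 1 := by
  obtain ⟨v, hvw, hv, hlen⟩ := exists_palindromic_sublist w hchain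
  exact ⟨v, hvw, hv, by omega⟩
end

section
/- Let k ≥ 2, n ≥ 1, and let w ∈ S_n be a word of type n over the alphabet {0,…,k−1}. If for some letter a and some p ≥ 1 the constant word a^p is a subsequence of w, then |w| ≥ k·n·(⌈p/n⌉ − 1); in particular |w| ≥ k·(p − n). -/
/-- The number of occurrences of a letter in an infix of a power of `B`, of length at most that of
`q` copies of `B`, is at most its number of occurrences in `q` copies of `B`. -/
theorem List.IsInfix.count_le_of_flatten_replicate {α : Type*} [DecidableEq α] {B w : List α}
    {m q : ℕ} (a : α) (hw : w <:+: (List.replicate m B).flatten)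
    (hlen : w.length ≤ q * B.length) : w.count a ≤ q * B.count a := by
  obtain ⟨s, t, hst⟩ := hw
  have hcomm : (List.replicate q B).flatten ++ (List.replicate m B).flatten =
      (List.replicate m B).flatten ++ (List.replicate q B).flatten := by
    simp only [← List.flatten_append, List.replicate_append_replicate, Nat.add_comm]
  have hleft : s ++ w <+: (List.replicate q B).flatten ++ (List.replicate m B).flatten :=
    ⟨t ++ (List.replicate q B).flatten, by rw [hcomm, ← hst]; simp⟩
  have hright : (List.replicate q B).flatten ++ s <+:
      (List.replicate q B).flatten ++ (List.replicate m B).flatten :=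
    ⟨w ++ t, by rw [← hst]; simp⟩
  have hpre : s ++ w <+: (List.replicate q B).flatten ++ s :=
    List.prefix_of_prefix_length_le hleft hright (by simp; lia)
  have hcount := hpre.sublist.count_le a
  simp only [List.count_append, List.count_flatten, List.map_replicate, List.sum_replicate,
    smul_eq_mul] at hcount
  lia

theorem length_blockWord (k n : ℕ) : (blockWord k n).length = k * n := by
  simp [blockWord, List.length_flatMap]

theorem count_blockWord_le (k n a : ℕ) : (blockWord k n).count a ≤ n := by
  induction k with
  | zero => simp [blockWord]
  | succ k ih =>
    by_cases hka : k = a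
    · subst hka
      have hnot : k ∉ blockWord k n := by
        simp [blockWord, List.mem_flatMap, List.mem_replicate]
      have hzero := List.count_eq_zero.mpr hnot
      simp only [blockWord] at hzero
      simp [blockWord, List.range_succ, hzero]
    · simpa [blockWord, List.range_succ, List.count_replicate, hka] using ih

theorem IsTypeWord.count_le {k n q : ℕ} {w : List ℕ} (hw : IsTypeWord k n w) (a : ℕ)
    (hlen : w.length ≤ q * (k * n)) : w.count a ≤ q * n := by
  rw [← length_blockWord k n] at hlen
  refine le_trans ?_ (Nat.mul_le_mul_left q (count_blockWord_le k n a))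
  obtain ⟨m, hw | hw⟩ := hw
  · exact hw.count_le_of_flatten_replicate a hlen
  · have hrev : w.reverse <:+: (List.replicate m (blockWord k n)).flatten := by
      simpa using List.reverse_infix.mpr hw
    simpa using hrev.count_le_of_flatten_replicate a (by simpa using hlen)

/-- If `w ∈ S_n` and the constant word `a^p` (with `p ≥ 1`) is a
subsequence of `w`, then `|w| ≥ k·n·(⌈p/n⌉ - 1)`; in particular `|w| ≥ k·(p - n)`.
Here `⌈p/n⌉ = (p + n - 1) / n` in natural-number arithmetic. -/
theorem constant_subseq_type_word_length_bound (k n p a : ℕ) (hk : 2 ≤ k) (hn : 1 ≤ n)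
    (hp : 1 ≤ p) (w : List ℕ) (hw : IsTypeWord k n w)
    (hsub : (List.replicate p a).Sublist w) :
    k * n * ((p + n - 1) / n - 1) ≤ w.length ∧ k * (p - n) ≤ w.length := by
  obtain ⟨q, hq⟩ : ∃ q, (p + n - 1) / n = q + 1 :=
    Nat.exists_eq_add_of_le' ((Nat.one_le_div_iff hn).mpr (by lia))
  have hlower : (q + 1) * n ≤ p + n - 1 := hq ▸ Nat.div_mul_le_self _ _
  have hupper : p + n - 1 < (q + 1 + 1) * n := (Nat.div_lt_iff_lt_mul hn).mp (by lia)
  have hcount : p ≤ w.count a := List.replicate_sublist_iff.mp hsub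
  have hmain : k * n * q ≤ w.length := by
    by_contra! hlt
    have hle := hw.count_le a (q := q) (by rw [Nat.mul_comm]; exact hlt.le)
    lia
  refine ⟨by simpa [hq] using hmain, le_trans ?_ hmain⟩
  rw [Nat.mul_assoc]
  exact Nat.mul_le_mul_left k (by lia)
end
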